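/- Let n ≥ 1 and let g_1, ..., g_n, h : ℝ → [0,∞] be symmetrically decreasing functions with 0 ≤ g_j ≤ 1 and ∫_ℝ g_j(t) dt = 1 for all 1 ≤ j ≤ n. Then ∫_ℝ h(x) (g_1 ∗ ⋯ ∗ g_n)(x) dx ≤ ∫_ℝ h(x) M_n(x) dx, where M_n is the centered cardinal B-spline of order n. -/

import Mathlib

open MeasureTheory Set

/-- Convolution of `[0,∞]`-valued functions on `ℝ`. -/
noncomputable def conv (f g : ℝ → ENNReal) (x : ℝ) : ENNReal := ∫⁻ y, f (x - y) * g y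

/-- A function `f : ℝ → [0,∞]` is symmetrically decreasing if `f(-x) = f(x)` for all `x`
and `f(y) ≤ f(x)` whenever `0 < x < y`. -/
def SymmDecr (f : ℝ → ENNReal) : Prop :=
  (∀ x : ℝ, f (-x) = f x) ∧ ∀ x y : ℝ, 0 < x → x < y → f y ≤ f x

/-- `M₁ = 1_{(−1/2, 1/2)}` as a `[0,∞]`-valued function. -/
noncomputable def M1 : ℝ → ENNReal := (Set.Ioo (-(1:ℝ)/2) (1/2)).indicator (fun _ => 1)

/-- Iterated convolution `g_0 ∗ g_1 ∗ ⋯ ∗ g_k`. -/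
noncomputable def iterConv (g : ℕ → ℝ → ENNReal) : ℕ → ℝ → ENNReal
  | 0 => g 0
  | k + 1 => conv (iterConv g k) (g (k + 1))

/-- The centered cardinal B-spline: `Mspline 0 = M₁`, `Mspline k = M₁ ∗ ⋯ ∗ M₁`
((k+1)-fold convolution), so that `Mspline (n-1)` is the B-spline `M_n` of order `n`. -/
noncomputable def Mspline : ℕ → ℝ → ENNReal
  | 0 => M1
  | k + 1 => conv (Mspline k) M1

/-- A symmetrically decreasing function agrees off `0` with an antitone function of `|x|`. -/
theorem SymmDecr.measurable {f : ℝ → ENNReal} (hf : SymmDecr f) : Measurable f := by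
  let k : ℝ → ENNReal := fun x => if x ≤ 0 then ⊤ else f x
  have hk : Antitone k := by
    intro x y hxy
    by_cases hx : x ≤ 0
    · simp [k, hx]
    · have hy : ¬ y ≤ 0 := by linarith
      rcases hxy.eq_or_lt with rfl | hlt
      · rfl
      · simpa [k, hx, hy] using hf.2 x y (not_le.1 hx) hlt
  have hfk : f = ({0} : Set ℝ).piecewise (fun _ => f 0) (fun x => k |x|) := by
    funext x
    by_cases hx : x = 0
    · simp [hx]
    · have : ¬ |x| ≤ 0 := by simpa using hx
      rw [Set.piecewise_eq_of_notMem _ _ _ (by simpa using hx)]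
      simp only [k, if_neg this]
      rcases abs_choice x with h | h <;> rw [h]
      exact (hf.1 x).symm
  rw [hfk]
  exact Measurable.piecewise (measurableSet_singleton 0) measurable_const
    (hk.measurable.comp measurable_abs)

theorem SymmDecr.le_of_abs_lt {f : ℝ → ENNReal} (hf : SymmDecr f) {x y : ℝ} (hx : x ≠ 0)
    (hxy : |x| < |y|) : f y ≤ f x := by
  have key : ∀ z, f |z| = f z := fun z => by
    rcases abs_choice z with h | h <;> rw [h]
    exact hf.1 z
  rw [← key x, ← key y]
  exact hf.2 _ _ (abs_pos.2 hx) hxy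

theorem measurable_conv {f g : ℝ → ENNReal} (hf : Measurable f) (hg : Measurable g) :
    Measurable (conv f g) := by
  unfold conv
  exact Measurable.lintegral_prod_right' (f := fun p : ℝ × ℝ => f (p.1 - p.2) * g p.2)
    (by fun_prop)

theorem conv_comm (f g : ℝ → ENNReal) : conv f g = conv g f := by
  funext x
  unfold conv
  rw [← lintegral_sub_left_eq_self _ x]
  simp [mul_comm]

theorem lintegral_mul_conv {h f g : ℝ → ENNReal} (hh : Measurable h) (hf : Measurable f)
    (hg : Measurable g) (hfe : ∀ x, f (-x) = f x) :
    ∫⁻ x, h x * conv f g x = ∫⁻ y, conv h f y * g y := by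
  rw [conv_comm h f]
  calc ∫⁻ x, h x * conv f g x = ∫⁻ x, ∫⁻ y, h x * (f (x - y) * g y) := by
        refine lintegral_congr fun x => ?_
        rw [conv, lintegral_const_mul _ (by fun_prop)]
    _ = ∫⁻ y, ∫⁻ x, h x * (f (x - y) * g y) := by
        apply lintegral_lintegral_swap
        apply Measurable.aemeasurable
        unfold Function.uncurry
        fun_prop
    _ = ∫⁻ y, conv f h y * g y := by
        refine lintegral_congr fun y => ?_
        rw [conv, ← lintegral_mul_const _ (by fun_prop)]
        refine lintegral_congr fun x => ?_
        rw [← hfe (y - x), neg_sub]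
        ring

theorem ENNReal.mul_add_mul_le_mul_add_mul_of_le {a b c d : ENNReal} (hab : b ≤ a)
    (hcd : d ≤ c) : b * c + a * d ≤ a * c + b * d := by
  obtain ⟨e, rfl⟩ := le_iff_exists_add.1 hab
  calc b * c + (b + e) * d = b * c + b * d + e * d := by ring
    _ ≤ b * c + b * d + e * c := by gcongr
    _ = (b + e) * c + b * d := by ring

theorem SymmDecr.conv {f g : ℝ → ENNReal} (hf : SymmDecr f) (hg : SymmDecr g) :
    SymmDecr (conv f g) := by
  have hfm := hf.measurable
  have hgm := hg.measurable
  refine ⟨fun x => ?_, fun x y hx hxy => ?_⟩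
  · unfold _root_.conv
    rw [← lintegral_neg_eq_self]
    refine lintegral_congr fun t => ?_
    rw [hg.1, ← hf.1]
    ring_nf
  · have half : ∀ t, t ≠ 0 → t ≠ x → t < x + y - t →
        f (y - t) * g t + f (x - t) * g (x + y - t) ≤
          f (x - t) * g t + f (y - t) * g (x + y - t) := by
      intro t h0 hx' ht
      refine ENNReal.mul_add_mul_le_mul_add_mul_of_le
        (hf.le_of_abs_lt (sub_ne_zero.2 hx'.symm) ?_) (hg.le_of_abs_lt h0 ?_)
      · exact abs_lt.2 ⟨by linarith [le_abs_self (y - t)], by linarith [le_abs_self (y - t)]⟩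
      · exact abs_lt.2 ⟨by linarith [le_abs_self (x + y - t)],
          by linarith [le_abs_self (x + y - t)]⟩
    have dbl : ∀ z, 2 * _root_.conv f g z =
        ∫⁻ t, (f (z - t) * g t + f (z - (x + y - t)) * g (x + y - t)) := by
      intro z
      rw [lintegral_add_left (by fun_prop),
        lintegral_sub_left_eq_self (fun t => f (z - t) * g t) (x + y), two_mul]
      rfl
    rw [← ENNReal.mul_le_mul_iff_right two_ne_zero ENNReal.ofNat_ne_top, dbl x, dbl y]
    apply lintegral_mono_ae
    have hae : ∀ c : ℝ, ∀ᵐ t : ℝ, t ≠ c := fun c => Measure.ae_ne volume c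
    filter_upwards [hae 0, hae x, hae y, hae (x + y)] with t h0 h1 h2 h3
    have e1 : f (x - (x + y - t)) = f (y - t) := by
      rw [← hf.1]; ring_nf
    have e2 : f (y - (x + y - t)) = f (x - t) := by
      rw [← hf.1]; ring_nf
    rw [e1, e2]
    rcases lt_trichotomy t (x + y - t) with ht | ht | ht
    · exact half t h0 h1 ht
    · rw [← ht, add_comm]
    · have := half (x + y - t) (by intro h; apply h3; linarith) (by intro h; apply h2; linarith)
        (by linarith)
      rw [e1, e2, sub_sub_cancel] at this
      simpa only [add_comm] using this

theorem measurable_M1 : Measurable M1 :=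
  measurable_const.indicator measurableSet_Ioo

theorem symmDecr_M1 : SymmDecr M1 := by
  refine ⟨fun x => ?_, fun x y hx hxy => ?_⟩
  · have : -x ∈ Ioo (-(1:ℝ)/2) (1/2) ↔ x ∈ Ioo (-(1:ℝ)/2) (1/2) := by
      simp only [mem_Ioo]
      constructor <;> rintro ⟨h1, h2⟩ <;> constructor <;> linarith
    simp only [M1, indicator, this]
  · by_cases hy : y ∈ Ioo (-(1:ℝ)/2) (1/2)
    · have hx' : x ∈ Ioo (-(1:ℝ)/2) (1/2) := ⟨by linarith, hxy.trans hy.2⟩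
      simp only [M1, indicator_of_mem hy, indicator_of_mem hx', le_refl]
    · simp only [M1, indicator_of_notMem hy, zero_le]

/-- The bathtub principle: `M1` maximises `∫ h g` among densities `g ≤ 1` of mass one. -/
theorem SymmDecr.lintegral_mul_le_lintegral_mul_M1 {h g : ℝ → ENNReal} (hh : SymmDecr h)
    (hg : Measurable g) (hg1 : ∀ x, g x ≤ 1) (hgint : ∫⁻ x, g x = 1) :
    ∫⁻ x, h x * g x ≤ ∫⁻ x, h x * M1 x := by
  have hhm := hh.measurable
  set s : Set ℝ := Ioo (-(1:ℝ)/2) (1/2) with hs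
  have hsm : MeasurableSet s := measurableSet_Ioo
  have hmass : ∫⁻ x in s, (1 - g x) = ∫⁻ x in sᶜ, g x := by
    have hfin : ∫⁻ x in s, g x ≠ ⊤ :=
      ((setLIntegral_le_lintegral s g).trans_lt (hgint ▸ ENNReal.one_lt_top)).ne
    have h1 : (∫⁻ x in s, g x) + ∫⁻ x in sᶜ, g x =
        (∫⁻ x in s, g x) + ∫⁻ x in s, (1 - g x) := by
      rw [lintegral_add_compl _ hsm, hgint, ← lintegral_add_left hg]
      simp only [add_tsub_cancel_of_le (hg1 _), lintegral_one, Measure.restrict_apply_univ, hs,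
        Real.volume_Ioo]
      norm_num
    exact ((ENNReal.add_right_inj hfin).1 h1).symm
  have hout : ∫⁻ x in sᶜ, h x * g x ≤ h (1/2) * ∫⁻ x in sᶜ, g x := by
    rw [← lintegral_const_mul _ hg]
    refine setLIntegral_mono' hsm.compl fun x hx => ?_
    gcongr
    have hx' : 1/2 ≤ |x| := by
      by_contra hlt
      rw [not_le, abs_lt] at hlt
      exact hx ⟨by linarith [hlt.1], hlt.2⟩
    rcases hx'.eq_or_lt with he | hlt
    · rcases abs_choice x with ha | ha <;> rw [he, ha]
      rw [hh.1]
    · exact hh.le_of_abs_lt (by norm_num) (by rwa [abs_of_pos (by norm_num : (0:ℝ) < 1/2)])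
  have hin : h (1/2) * ∫⁻ x in s, (1 - g x) ≤ ∫⁻ x in s, h x * (1 - g x) := by
    rw [← lintegral_const_mul _ (by fun_prop)]
    refine lintegral_mono_ae ?_
    filter_upwards [ae_restrict_mem hsm, Measure.ae_ne (volume.restrict s) 0] with x hx h0
    gcongr
    refine hh.le_of_abs_lt h0 ?_
    rw [abs_of_pos (by norm_num : (0:ℝ) < 1/2)]
    exact abs_lt.2 ⟨by linarith [hx.1], hx.2⟩
  calc ∫⁻ x, h x * g x = (∫⁻ x in s, h x * g x) + ∫⁻ x in sᶜ, h x * g x :=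
        (lintegral_add_compl _ hsm).symm
    _ ≤ (∫⁻ x in s, h x * g x) + ∫⁻ x in s, h x * (1 - g x) := by
        exact add_le_add_right (hout.trans (hmass ▸ hin)) _
    _ = ∫⁻ x in s, h x := by
        rw [← lintegral_add_left (by fun_prop)]
        simp only [← mul_add, add_tsub_cancel_of_le (hg1 _), mul_one]
    _ = ∫⁻ x, h x * M1 x := by
        rw [← lintegral_indicator hsm]
        refine lintegral_congr fun x => ?_
        by_cases hx : x ∈ s <;> simp only [M1, ← hs, indicator, hx, if_true, if_false, mul_one, mul_zero]

theorem measurable_Mspline (k : ℕ) : Measurable (Mspline k) := by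
  induction k with
  | zero => exact measurable_M1
  | succ k ih => exact measurable_conv ih measurable_M1

theorem symmDecr_iterConv {g : ℕ → ℝ → ENNReal} {k : ℕ} (hg : ∀ j ≤ k, SymmDecr (g j)) :
    SymmDecr (iterConv g k) := by
  induction k with
  | zero => exact hg 0 le_rfl
  | succ k ih => exact (ih fun j hj => hg j (by omega)).conv (hg (k + 1) le_rfl)

theorem lintegral_mul_iterConv_le {g : ℕ → ℝ → ENNReal} {k : ℕ}
    (hgsd : ∀ j ≤ k, SymmDecr (g j)) (hg1 : ∀ j ≤ k, ∀ x, g j x ≤ 1)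
    (hgint : ∀ j ≤ k, ∫⁻ x, g j x = 1) {h : ℝ → ENNReal} (hh : SymmDecr h) :
    ∫⁻ x, h x * iterConv g k x ≤ ∫⁻ x, h x * Mspline k x := by
  induction k generalizing h with
  | zero =>
    exact hh.lintegral_mul_le_lintegral_mul_M1 (hgsd 0 le_rfl).measurable (hg1 0 le_rfl)
      (hgint 0 le_rfl)
  | succ k ih =>
    have hI : SymmDecr (iterConv g k) := symmDecr_iterConv fun j hj => hgsd j (by omega)
    have hgk := (hgsd (k + 1) le_rfl).measurable
    calc ∫⁻ x, h x * conv (iterConv g k) (g (k + 1)) x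
        = ∫⁻ x, conv h (iterConv g k) x * g (k + 1) x :=
          lintegral_mul_conv hh.measurable hI.measurable hgk hI.1
      _ ≤ ∫⁻ x, conv h (iterConv g k) x * M1 x :=
          (hh.conv hI).lintegral_mul_le_lintegral_mul_M1 hgk (hg1 _ le_rfl) (hgint _ le_rfl)
      _ = ∫⁻ x, h x * conv (iterConv g k) M1 x :=
          (lintegral_mul_conv hh.measurable hI.measurable measurable_M1 hI.1).symm
      _ = ∫⁻ x, conv h M1 x * iterConv g k x := by
          rw [conv_comm _ M1,
            lintegral_mul_conv hh.measurable measurable_M1 hI.measurable symmDecr_M1.1]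
      _ ≤ ∫⁻ x, conv h M1 x * Mspline k x :=
          ih (fun j hj => hgsd j (by omega)) (fun j hj => hg1 j (by omega))
            (fun j hj => hgint j (by omega)) (hh.conv symmDecr_M1)
      _ = ∫⁻ x, h x * conv (Mspline k) M1 x := by
          rw [conv_comm (Mspline k) M1, lintegral_mul_conv hh.measurable measurable_M1
            (measurable_Mspline k) symmDecr_M1.1]

theorem iterated_conv_inequality (n : ℕ) (hn : 1 ≤ n)
    (g : ℕ → ℝ → ENNReal) (h : ℝ → ENNReal)
    (hgsd : ∀ j, j < n → SymmDecr (g j))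
    (hg1 : ∀ j, j < n → ∀ x, g j x ≤ 1)
    (hgint : ∀ j, j < n → ∫⁻ x, g j x = 1)
    (hh : SymmDecr h) :
    ∫⁻ x, h x * iterConv g (n - 1) x ≤ ∫⁻ x, h x * Mspline (n - 1) x := by
  exact lintegral_mul_iterConv_le (fun j hj => hgsd j (by omega)) (fun j hj => hg1 j (by omega))
    (fun j hj => hgint j (by omega)) hh
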